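/- arXiv:1906.05493 — 2 statements merged into one kernel-verified Lean document; each statement's English description precedes it below -/
import Mathlib

section
/- Let P ⊆ R^d be a spanning pointed closed convex cone with interior Ω, and let f : P → (0, ∞) satisfy f(x+y) = f(x)f(y) for all x, y ∈ P. Assume f is measurable. Then there exists λ ∈ R^d such that f(x) = e^{⟨λ, x⟩} for all x ∈ P. -/
open scoped RealInnerProductSpace

/-- A function that is additive and measurable on the nonnegative reals is linear there. -/
theorem eq_mul_of_additive_of_measurable_nonneg (h : ℝ → ℝ)
    (hadd : ∀ s, 0 ≤ s → ∀ t, 0 ≤ t → h (s + t) = h s + h t)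
    (hmeas : Measurable fun t : ℝ => h (max t 0)) {t : ℝ} (ht : 0 ≤ t) :
    h t = t * h 1 := by
  have hzero : h 0 = 0 := by
    have := hadd 0 le_rfl 0 le_rfl
    simpa using this
  let g : ℝ →+ ℝ := AddMonoidHom.mk' (fun t => h (max t 0) - h (max (-t) 0)) (by
    intro s t
    have p (r : ℝ) : 0 ≤ max r 0 := le_max_right _ _
    have key : max (s + t) 0 + (max (-s) 0 + max (-t) 0)
        = max (-(s + t)) 0 + (max s 0 + max t 0) := by
      have q (r : ℝ) : max r 0 = max (-r) 0 + r := by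
        rcases le_total r 0 with hr | hr
        · rw [max_eq_right hr, max_eq_left (by linarith)]; ring
        · rw [max_eq_left hr, max_eq_right (by linarith)]; ring
      linarith [q s, q t, q (s + t)]
    have e := congrArg h key
    rw [hadd _ (p _) _ (add_nonneg (p _) (p _)), hadd _ (p _) _ (p _),
      hadd _ (p _) _ (add_nonneg (p _) (p _)), hadd _ (p _) _ (p _)] at e
    linarith)
  have hg : Measurable g := hmeas.sub (hmeas.comp measurable_neg)
  have hc : Continuous g := MeasureTheory.Measure.AddMonoidHom.continuous_of_measurable g hg
  have hval (r : ℝ) (hr : 0 ≤ r) : g r = h r := by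
    change h (max r 0) - h (max (-r) 0) = h r
    rw [max_eq_left hr, max_eq_right (by linarith), hzero, sub_zero]
  have e := map_real_smul g hc t 1
  rwa [smul_eq_mul, mul_one, smul_eq_mul, hval t ht, hval 1 zero_le_one] at e

/-- An additive, positively homogeneous function on a generating set closed under addition and
nonnegative scaling extends to a linear functional. -/
theorem exists_linearMap_eq_of_additive_on_cone {E : Type*} [AddCommGroup E] [Module ℝ E]
    (P : Set E) (haddP : ∀ x ∈ P, ∀ y ∈ P, x + y ∈ P)
    (hcone : ∀ c : ℝ, 0 ≤ c → ∀ x ∈ P, c • x ∈ P)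
    (hspan : ∀ v : E, ∃ x ∈ P, ∃ y ∈ P, v = x - y) (g : E → ℝ)
    (hadd : ∀ x ∈ P, ∀ y ∈ P, g (x + y) = g x + g y)
    (hsmul : ∀ c : ℝ, 0 ≤ c → ∀ x ∈ P, g (c • x) = c * g x) :
    ∃ L : E →ₗ[ℝ] ℝ, ∀ x ∈ P, L x = g x := by
  choose a ha b hb hab using hspan
  have wd (v x y : E) (hx : x ∈ P) (hy : y ∈ P) (hv : v = x - y) :
      g (a v) - g (b v) = g x - g y := by
    have e : a v + y = x + b v := by
      have := (hab v).symm.trans hv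
      rwa [sub_eq_sub_iff_add_eq_add] at this
    have e' := congrArg g e
    rw [hadd _ (ha v) _ hy, hadd _ hx _ (hb v)] at e'
    linarith
  refine ⟨{ toFun := fun v => g (a v) - g (b v), map_add' := ?_, map_smul' := ?_ }, ?_⟩
  · intro v w
    rw [wd (v + w) (a v + a w) (b v + b w) (haddP _ (ha v) _ (ha w)) (haddP _ (hb v) _ (hb w))
      (by conv_lhs => rw [hab v, hab w]
          abel), hadd _ (ha v) _ (ha w), hadd _ (hb v) _ (hb w)]
    ring
  · intro c v
    simp only [RingHom.id_apply, smul_eq_mul]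
    rcases le_total 0 c with hc | hc
    · rw [wd (c • v) (c • a v) (c • b v) (hcone c hc _ (ha v)) (hcone c hc _ (hb v))
        (by rw [← smul_sub, ← hab v]), hsmul c hc _ (ha v), hsmul c hc _ (hb v)]
      ring
    · have hc' : 0 ≤ -c := by linarith
      rw [wd (c • v) ((-c) • b v) ((-c) • a v) (hcone _ hc' _ (hb v)) (hcone _ hc' _ (ha v))
        (by rw [← smul_sub, neg_smul, ← smul_neg, neg_sub, ← hab v]),
        hsmul _ hc' _ (ha v), hsmul _ hc' _ (hb v)]
      ring
  · intro x hx
    change g (a x) - g (b x) = g x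
    rw [wd x (x + x) x (haddP _ hx _ hx) hx (by abel), hadd _ hx _ hx]
    ring

theorem stmt12 {d : ℕ} (P : Set (EuclideanSpace ℝ (Fin d)))
    (hclosed : IsClosed P) (hconv : Convex ℝ P)
    (hcone : ∀ c : ℝ, 0 ≤ c → ∀ x ∈ P, c • x ∈ P)
    (hspan : ∀ v : EuclideanSpace ℝ (Fin d), ∃ x ∈ P, ∃ y ∈ P, v = x - y)
    (hpointed : P ∩ (-P) = {0})
    (f : EuclideanSpace ℝ (Fin d) → ℝ)
    (hpos : ∀ x ∈ P, 0 < f x)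
    (hmul : ∀ x ∈ P, ∀ y ∈ P, f (x + y) = f x * f y)
    (hmeas : Measurable (fun x : P => f x)) :
    ∃ l : EuclideanSpace ℝ (Fin d), ∀ x ∈ P, f x = Real.exp ⟪l, x⟫ := by
  have haddP : ∀ x ∈ P, ∀ y ∈ P, x + y ∈ P := by
    intro x hx y hy
    have h := hcone 2 (by norm_num) _
      (hconv hx hy (a := 1 / 2) (b := 1 / 2) (by norm_num) (by norm_num) (by norm_num))
    rwa [smul_add, smul_smul, smul_smul, show (2 : ℝ) * (1 / 2) = 1 by norm_num, one_smul,
      one_smul] at h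
  have hadd : ∀ x ∈ P, ∀ y ∈ P,
      Real.log (f (x + y)) = Real.log (f x) + Real.log (f y) := by
    intro x hx y hy
    rw [hmul x hx y hy, Real.log_mul (hpos x hx).ne' (hpos y hy).ne']
  have hsmul : ∀ c : ℝ, 0 ≤ c → ∀ x ∈ P, Real.log (f (c • x)) = c * Real.log (f x) := by
    intro c hc x hx
    have hray : Measurable fun t : ℝ =>
        (⟨max t 0 • x, hcone _ (le_max_right _ _) x hx⟩ : P) :=
      Continuous.measurable (by fun_prop)
    have h := eq_mul_of_additive_of_measurable_nonneg (fun t => Real.log (f (t • x)))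
      (fun s hs t ht => by
        simp only [add_smul]
        exact hadd _ (hcone s hs x hx) _ (hcone t ht x hx))
      (Real.measurable_log.comp (hmeas.comp hray)) hc
    simpa using h
  obtain ⟨L, hL⟩ := exists_linearMap_eq_of_additive_on_cone P haddP hcone hspan
    (fun x => Real.log (f x)) hadd hsmul
  refine ⟨(InnerProductSpace.toDual ℝ _).symm (LinearMap.toContinuousLinearMap L), ?_⟩
  intro x hx
  rw [InnerProductSpace.toDual_symm_apply, LinearMap.coe_toContinuousLinearMap', hL x hx,
    Real.exp_log (hpos x hx)]
end

section
/- Let P ⊆ R^d be a spanning pointed closed convex cone with interior Ω, and V = (V_x)_{x∈Ω} a semigroup of isometries on a separable Hilbert space H such that for each a ∈ Ω and ξ ∈ H, the map (0,∞) ∋ t ↦ V_{ta} ξ is continuous. Then for every ξ ∈ H the map Ω ∋ x ↦ V_x ξ is continuous. -/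
open Filter Topology in
/-- An isometric semigroup which is strongly continuous on an open ray is strongly continuous at
the apex of the ray. -/
theorem tendsto_apply_smul_of_isometric {E H : Type*} [AddCommGroup E] [Module ℝ E]
    [NormedAddCommGroup H] [NormedSpace ℂ H] {S : AddSubmonoid E} {W : E → H →L[ℂ] H}
    (hiso : ∀ x ∈ S, ∀ h : H, ‖W x h‖ = ‖h‖)
    (hadd : ∀ x ∈ S, ∀ y ∈ S, W (x + y) = (W x).comp (W y)) {a : E}
    (ha : ∀ t : ℝ, 0 ≤ t → t • a ∈ S) (ξ : H)
    (hray : ContinuousOn (fun t : ℝ => W (t • a) ξ) (Set.Ioi 0)) :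
    Tendsto (fun t : ℝ => W (t • a) ξ) (𝓝[≥] 0) (𝓝 ξ) := by
  rw [tendsto_iff_norm_sub_tendsto_zero]
  have hcont : ContinuousAt (fun t : ℝ => W (t • a) ξ) (1 + 0) :=
    hray.continuousAt (Ioi_mem_nhds (by norm_num))
  have hshift : Tendsto (fun t : ℝ => W ((1 + t) • a) ξ) (𝓝[≥] 0) (𝓝 (W ((1 : ℝ) • a) ξ)) := by
    have h := hcont.tendsto.comp
      ((continuous_const_add (1 : ℝ)).tendsto 0 |>.mono_left (nhdsWithin_le_nhds (s := Set.Ici 0)))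
    simpa [Function.comp_def] using h
  refine (tendsto_iff_norm_sub_tendsto_zero.1 hshift).congr' ?_
  filter_upwards [self_mem_nhdsWithin] with t ht
  rw [add_smul, hadd _ (ha 1 zero_le_one) _ (ha t ht), ContinuousLinearMap.comp_apply, ← map_sub,
    hiso _ (ha 1 zero_le_one)]

theorem norm_apply_sum_sub_le_of_isometric {ι E H : Type*} [AddCommMonoid E]
    [NormedAddCommGroup H] [NormedSpace ℂ H] {S : AddSubmonoid E} {W : E → H →L[ℂ] H}
    (hzero : W 0 = 1) (hiso : ∀ x ∈ S, ∀ h : H, ‖W x h‖ = ‖h‖)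
    (hadd : ∀ x ∈ S, ∀ y ∈ S, W (x + y) = (W x).comp (W y))
    (s : Finset ι) (f : ι → E) (hf : ∀ i ∈ s, f i ∈ S) (ξ : H) :
    ‖W (∑ i ∈ s, f i) ξ - ξ‖ ≤ ∑ i ∈ s, ‖W (f i) ξ - ξ‖ := by
  classical
  induction s using Finset.induction_on with
  | empty => simp [hzero]
  | insert i s hi ih =>
    have hfi := hf i (Finset.mem_insert_self i s)
    have hfs : ∀ j ∈ s, f j ∈ S := fun j hj => hf j (Finset.mem_insert_of_mem hj)
    rw [Finset.sum_insert hi, Finset.sum_insert hi, hadd _ hfi _ (S.sum_mem hfs),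
      ContinuousLinearMap.comp_apply]
    calc ‖W (f i) (W (∑ j ∈ s, f j) ξ) - ξ‖
        = ‖W (f i) (W (∑ j ∈ s, f j) ξ - ξ) + (W (f i) ξ - ξ)‖ := by rw [map_sub]; abel_nf
      _ ≤ ‖W (f i) (W (∑ j ∈ s, f j) ξ - ξ)‖ + ‖W (f i) ξ - ξ‖ := norm_add_le _ _
      _ ≤ ‖W (f i) ξ - ξ‖ + ∑ j ∈ s, ‖W (f j) ξ - ξ‖ := by
        rw [hiso _ hfi, add_comm]
        gcongr
        exact ih hfs

theorem norm_apply_sub_apply_le_of_isometric {E H : Type*} [AddCommMonoid E]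
    [NormedAddCommGroup H] [NormedSpace ℂ H] {S : AddSubmonoid E} {W : E → H →L[ℂ] H}
    (hiso : ∀ x ∈ S, ∀ h : H, ‖W x h‖ = ‖h‖)
    (hadd : ∀ x ∈ S, ∀ y ∈ S, W (x + y) = (W x).comp (W y))
    {x y u w : E} (hx : x ∈ S) (hy : y ∈ S) (hu : u ∈ S) (hw : w ∈ S) (h : y + u = x + w) (ξ : H) :
    ‖W y ξ - W x ξ‖ ≤ ‖W w ξ - ξ‖ + ‖W u ξ - ξ‖ := by
  have hcomp : W y (W u ξ) = W x (W w ξ) := by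
    rw [← ContinuousLinearMap.comp_apply, ← ContinuousLinearMap.comp_apply, ← hadd y hy u hu,
      ← hadd x hx w hw, h]
  calc ‖W y ξ - W x ξ‖ = ‖W x (W w ξ - ξ) - W y (W u ξ - ξ)‖ := by
        rw [map_sub, map_sub, hcomp]; abel_nf
    _ ≤ ‖W x (W w ξ - ξ)‖ + ‖W y (W u ξ - ξ)‖ := norm_sub_le _ _
    _ = _ := by rw [hiso x hx, hiso y hy]

open Filter Topology in
/-- An isometric semigroup indexed by a submonoid containing the positive multiples of a basis is
strongly continuous as soon as it is strongly continuous along the rays of the basis. -/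
theorem continuousOn_apply_of_isometric_of_basis {ι E H : Type*} [Finite ι]
    [NormedAddCommGroup E] [NormedSpace ℝ E]
    [NormedAddCommGroup H] [NormedSpace ℂ H] {S : AddSubmonoid E} {W : E → H →L[ℂ] H}
    (hzero : W 0 = 1) (hiso : ∀ x ∈ S, ∀ h : H, ‖W x h‖ = ‖h‖)
    (hadd : ∀ x ∈ S, ∀ y ∈ S, W (x + y) = (W x).comp (W y)) (b : Module.Basis ι ℝ E)
    (hb : ∀ i, ∀ t : ℝ, 0 ≤ t → t • b i ∈ S) (ξ : H)
    (hray : ∀ i, ContinuousOn (fun t : ℝ => W (t • b i) ξ) (Set.Ioi 0)) :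
    ContinuousOn (fun x => W x ξ) S := by
  have := Fintype.ofFinite ι
  have := b.finiteDimensional_of_finite
  have hsum (c : E → ι → ℝ) (hc : ∀ y i, 0 ≤ c y i) (y : E) :
      ∑ i, c y i • b i ∈ S := S.sum_mem fun i _ => hb i _ (hc y i)
  have hlim (x : E) (c : E → ι → ℝ) (hc : ∀ y i, 0 ≤ c y i)
      (hcx : ∀ i, Tendsto (fun y => c y i) (𝓝[S] x) (𝓝 0)) :
      Tendsto (fun y => ‖W (∑ i, c y i • b i) ξ - ξ‖) (𝓝[S] x) (𝓝 0) := by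
    refine squeeze_zero (fun _ => norm_nonneg _) (fun y =>
      norm_apply_sum_sub_le_of_isometric hzero hiso hadd _ _ (fun i _ => hb i _ (hc y i)) ξ) ?_
    rw [← Finset.sum_const_zero (s := (Finset.univ : Finset ι))]
    refine tendsto_finsetSum _ fun i _ => tendsto_iff_norm_sub_tendsto_zero.1 ?_
    exact (tendsto_apply_smul_of_isometric hiso hadd (hb i) ξ (hray i)).comp
      (tendsto_nhdsWithin_iff.2 ⟨hcx i, Eventually.of_forall fun y => hc y i⟩)
  intro x hx
  have hcoord (i : ι) : Continuous (b.coord i) := LinearMap.continuous_of_finiteDimensional _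
  let p (y : E) (i : ι) : ℝ := max (b.coord i (y - x)) 0
  let n (y : E) (i : ι) : ℝ := max (-b.coord i (y - x)) 0
  have hp (y : E) (i : ι) : 0 ≤ p y i := le_max_right _ _
  have hn (y : E) (i : ι) : 0 ≤ n y i := le_max_right _ _
  have hpn (y : E) : y + ∑ i, n y i • b i = x + ∑ i, p y i • b i := by
    have hdiff : ∑ i, p y i • b i - ∑ i, n y i • b i = y - x := by
      rw [← Finset.sum_sub_distrib]
      refine Eq.trans (Finset.sum_congr rfl fun i _ => ?_) (b.sum_repr (y - x))
      rw [← sub_smul]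
      congr 1
      have := max_zero_sub_max_neg_zero_eq_self (b.coord i (y - x))
      simpa only [p, n, max_comm, Module.Basis.coord_apply] using this
    rw [← sub_eq_zero, add_sub_add_comm, ← hdiff]
    abel
  have hpx (i : ι) : Tendsto (fun y => p y i) (𝓝[S] x) (𝓝 0) := by
    have : Continuous fun y => p y i := by have := hcoord i; fun_prop
    simpa [p] using (this.tendsto x).mono_left nhdsWithin_le_nhds
  have hnx (i : ι) : Tendsto (fun y => n y i) (𝓝[S] x) (𝓝 0) := by
    have : Continuous fun y => n y i := by have := hcoord i; fun_prop
    simpa [n] using (this.tendsto x).mono_left nhdsWithin_le_nhds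
  refine tendsto_iff_norm_sub_tendsto_zero.2 ?_
  refine squeeze_zero' (Eventually.of_forall fun _ => norm_nonneg _) ?_
    (by simpa using (hlim x p hp hpx).add (hlim x n hn hnx))
  filter_upwards [self_mem_nhdsWithin] with y hy
  exact norm_apply_sub_apply_le_of_isometric hiso hadd hx hy (hsum n hn y) (hsum p hp y) (hpn y) ξ

theorem exists_basis_mem_of_isOpen.{u} {E : Type u} [NormedAddCommGroup E] [NormedSpace ℝ E]
    {U : Set E} (hU : IsOpen U) (hne : U.Nonempty) :
    ∃ (ι : Type u) (b : Module.Basis ι ℝ E), ∀ i, b i ∈ U := by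
  have hspan : Submodule.span ℝ U = ⊤ :=
    Submodule.eq_top_of_nonempty_interior' _
      (hne.mono (interior_maximal Submodule.subset_span hU))
  exact ⟨_, Module.Basis.ofSpan hspan.ge, fun i =>
    Module.Basis.ofSpan_subset hspan.ge (Set.mem_range_self i)⟩

open scoped Pointwise in
theorem smul_mem_interior_of_cone {E : Type*} [NormedAddCommGroup E] [NormedSpace ℝ E] {P : Set E}
    (hcone : ∀ c : ℝ, 0 ≤ c → ∀ x ∈ P, c • x ∈ P) {c : ℝ} (hc : 0 < c) {x : E}
    (hx : x ∈ interior P) : c • x ∈ interior P := by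
  have hsub : c • P ⊆ P := Set.smul_set_subset_iff.2 fun y hy => hcone c hc.le y hy
  have := Set.smul_mem_smul_set (a := c) hx
  rw [← interior_smul₀ hc.ne'] at this
  exact interior_mono hsub this

theorem add_mem_interior_of_cone {E : Type*} [NormedAddCommGroup E] [NormedSpace ℝ E] {P : Set E}
    (hconv : Convex ℝ P) (hcone : ∀ c : ℝ, 0 ≤ c → ∀ x ∈ P, c • x ∈ P) {x y : E}
    (hx : x ∈ interior P) (hy : y ∈ interior P) : x + y ∈ interior P := by
  have hmid := hconv.interior hx hy (a := 2⁻¹) (b := 2⁻¹) (by norm_num) (by norm_num)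
    (by norm_num)
  have := smul_mem_interior_of_cone hcone (c := 2) two_pos hmid
  simpa [smul_add, smul_smul] using this


theorem stmt14 {d : ℕ} {H : Type*} [NormedAddCommGroup H]
    [InnerProductSpace ℂ H] [CompleteSpace H] [TopologicalSpace.SeparableSpace H]
    (P : Set (EuclideanSpace ℝ (Fin d)))
    (hclosed : IsClosed P) (hconv : Convex ℝ P)
    (hcone : ∀ c : ℝ, 0 ≤ c → ∀ x ∈ P, c • x ∈ P)
    (hspan : ∀ v : EuclideanSpace ℝ (Fin d), ∃ x ∈ P, ∃ y ∈ P, v = x - y)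
    (hpointed : P ∩ (-P) = {0})
    (V : EuclideanSpace ℝ (Fin d) → H →L[ℂ] H)
    (hiso : ∀ x ∈ interior P, ∀ h : H, ‖V x h‖ = ‖h‖)
    (hsemi : ∀ x ∈ interior P, ∀ y ∈ interior P, (V x).comp (V y) = V (x + y))
    (hray : ∀ a ∈ interior P, ∀ ξ : H,
      ContinuousOn (fun t : ℝ => V (t • a) ξ) (Set.Ioi (0 : ℝ))) :
    ∀ ξ : H, ContinuousOn (fun x => V x ξ) (interior P) := by
  intro ξ
  classical
  rcases (interior P).eq_empty_or_nonempty with hempty | hne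
  · simp [hempty]
  obtain ⟨ι, b, hb⟩ := exists_basis_mem_of_isOpen isOpen_interior hne
  have : Finite ι := Module.Finite.finite_basis b
  let S : AddSubmonoid (EuclideanSpace ℝ (Fin d)) :=
    { carrier := insert 0 (interior P)
      zero_mem' := Set.mem_insert _ _
      add_mem' := by
        rintro x y (rfl | hx) (rfl | hy)
        · simp
        · exact Or.inr (by rwa [zero_add])
        · exact Or.inr (by rwa [add_zero])
        · exact Or.inr (add_mem_interior_of_cone hconv hcone hx hy) }
  let W : EuclideanSpace ℝ (Fin d) → H →L[ℂ] H := Function.update V 0 1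
  have hW0 : W 0 = 1 := Function.update_self _ _ _
  have hWV : ∀ x ∈ interior P, W x = V x := by
    intro x hx
    rcases eq_or_ne x 0 with rfl | hx0
    · rw [hW0]
      ext h
      have hidem : V 0 (V 0 h) = V 0 h := by
        rw [← ContinuousLinearMap.comp_apply, hsemi 0 hx 0 hx, add_zero]
      have hnorm : ‖V 0 h - h‖ = 0 := by
        rw [← hiso 0 hx, map_sub, hidem, sub_self, norm_zero]
      exact (sub_eq_zero.1 (norm_eq_zero.1 hnorm)).symm
    · exact Function.update_of_ne hx0 _ _
  have hWiso : ∀ x ∈ S, ∀ h : H, ‖W x h‖ = ‖h‖ := by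
    rintro x (rfl | hx) h
    · simp [hW0]
    · rw [hWV x hx, hiso x hx]
  have hWadd : ∀ x ∈ S, ∀ y ∈ S, W (x + y) = (W x).comp (W y) := by
    rintro x (rfl | hx) y (rfl | hy)
    · ext; simp [hW0]
    · ext; simp [hW0]
    · ext; simp [hW0]
    · rw [hWV x hx, hWV y hy, hWV _ (add_mem_interior_of_cone hconv hcone hx hy), hsemi x hx y hy]
  have hbS : ∀ i, ∀ t : ℝ, 0 ≤ t → t • b i ∈ S := by
    intro i t ht
    rcases ht.eq_or_lt with rfl | ht
    · simp
    · exact Or.inr (smul_mem_interior_of_cone hcone ht (hb i))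
  have hWray : ∀ i, ContinuousOn (fun t : ℝ => W (t • b i) ξ) (Set.Ioi 0) := fun i =>
    (hray (b i) (hb i) ξ).congr fun t ht => by
      simp only [hWV _ (smul_mem_interior_of_cone hcone ht (hb i))]
  exact ((continuousOn_apply_of_isometric_of_basis hW0 hWiso hWadd b hbS ξ hWray).mono
    (Set.subset_insert _ _)).congr fun x hx => by simp only [hWV x hx]
end
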